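/- Let G be a finite simple graph. Then ν(G \ v) = ν(G) for every vertex v of G if and only if, for every maximum matching M of G, every vertex of G is a star vertex of G relative to M. -/

import Mathlib

open SimpleGraph

/-- `M` is a matching of `G`: a set of edges of `G` that are pairwise vertex-disjoint. -/
def IsMatchingSet {V : Type} (G : SimpleGraph V) (M : Set (Sym2 V)) : Prop :=
  M ⊆ G.edgeSet ∧ M.Pairwise fun e f => ∀ v : V, v ∈ e → v ∉ f

/-- The matching number `ν(G)`: the maximum size of a matching in `G`. -/
noncomputable def nu {V : Type} (G : SimpleGraph V) : ℕ :=
  sSup {n | ∃ M : Set (Sym2 V), IsMatchingSet G M ∧ M.ncard = n}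

/-- `v` is saturated (covered) by the matching `M`. -/
def MSaturates {V : Type} (M : Set (Sym2 V)) (v : V) : Prop := ∃ e ∈ M, v ∈ e

/-- The edges of the walk `p` alternate: the `i`-th edge belongs to `M` iff `i` is odd
(so the walk starts with a non-matching edge). -/
def IsAlternating {V : Type} (M : Set (Sym2 V)) {G : SimpleGraph V} {a b : V}
    (p : G.Walk a b) : Prop :=
  ∀ (i : ℕ) (h : i < p.edges.length), (p.edges[i]'h ∈ M ↔ Odd i)

/-- A star path of `G` relative to `M`: a path of even length, alternating starting with a
non-matching edge, whose initial vertex is `M`-unsaturated. -/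
def IsStarPath {V : Type} (M : Set (Sym2 V)) {G : SimpleGraph V} {a b : V}
    (p : G.Walk a b) : Prop :=
  p.IsPath ∧ Even p.length ∧ ¬ MSaturates M a ∧ IsAlternating M p

/-- `v` is a star vertex of `G` relative to `M`: some star path terminates at `v`. -/
def IsStarVertex {V : Type} (G : SimpleGraph V) (M : Set (Sym2 V)) (v : V) : Prop :=
  ∃ a : V, ∃ p : G.Walk a v, IsStarPath M p

/-- An `M`-augmenting path: a path of odd length, alternating starting and ending with
non-matching edges, both of whose endpoints are `M`-unsaturated. -/
def IsAugPath {V : Type} (M : Set (Sym2 V)) {G : SimpleGraph V} {a b : V}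
    (p : G.Walk a b) : Prop :=
  p.IsPath ∧ Odd p.length ∧ ¬ MSaturates M a ∧ ¬ MSaturates M b ∧ IsAlternating M p

/-- `G ∈ F(d,m)`: `G` is a finite simple graph with maximum degree `< d` and matching
number `< m`, edge-maximal with this property among all finite graphs on vertex sets
containing `V(G)`. -/
def MemF (d m : ℕ) {V : Type} [Fintype V] (G : SimpleGraph V) : Prop :=
  (∀ v : V, (G.neighborSet v).ncard < d) ∧ nu G < m ∧
  ∀ (W : Type) [Fintype W] (f : V ↪ W) (G' : SimpleGraph W),
    (∀ u v : V, G.Adj u v → G'.Adj (f u) (f v)) →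
    G.edgeSet.ncard < G'.edgeSet.ncard →
    (∃ w : W, d ≤ (G'.neighborSet w).ncard) ∨ m ≤ nu G'

theorem IsMatchingSet.eq_of_mem {V : Type} {G : SimpleGraph V} {M : Set (Sym2 V)}
    (hM : IsMatchingSet G M) {e f : Sym2 V} (he : e ∈ M) (hf : f ∈ M) {x : V}
    (hxe : x ∈ e) (hxf : x ∈ f) : e = f := by
  by_contra hne
  exact hM.2 he hf hne x hxe hxf

theorem IsMatchingSet.insert_of_not_saturates {V : Type} {G : SimpleGraph V} {M : Set (Sym2 V)}
    (hM : IsMatchingSet G M) {a b : V} (hab : G.Adj a b) (ha : ¬ MSaturates M a)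
    (hb : ¬ MSaturates M b) : IsMatchingSet G (insert s(a, b) M) := by
  refine ⟨Set.insert_subset hab hM.1, ?_⟩
  have key : ∀ e ∈ M, ∀ x ∈ e, x ∉ s(a, b) := by
    intro e he x hxe hx
    rcases Sym2.mem_iff.1 hx with rfl | rfl
    · exact ha ⟨e, he, hxe⟩
    · exact hb ⟨e, he, hxe⟩
  rintro e (rfl | he) f (rfl | hf) hne x hxe hxf
  · exact hne rfl
  · exact key f hf x hxf hxe
  · exact key e he x hxe hxf
  · exact hM.2 he hf hne x hxe hxf

theorem IsMatchingSet.not_saturates_sdiff {V : Type} {G : SimpleGraph V} {M : Set (Sym2 V)}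
    (hM : IsMatchingSet G M) {e : Sym2 V} (he : e ∈ M) {x : V} (hx : x ∈ e) :
    ¬ MSaturates (M \ {e}) x := by
  rintro ⟨f, ⟨hf, hne⟩, hxf⟩
  exact hne (hM.eq_of_mem hf he hxf hx)

theorem IsMatchingSet.exchange {V : Type} {G : SimpleGraph V} {M : Set (Sym2 V)}
    (hM : IsMatchingSet G M) {a b c : V} (hab : G.Adj a b) (ha : ¬ MSaturates M a)
    (hbc : s(b, c) ∈ M) : IsMatchingSet G (insert s(a, b) (M \ {s(b, c)})) := by
  have hM' : IsMatchingSet G (M \ {s(b, c)}) :=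
    ⟨Set.sdiff_subset.trans hM.1, hM.2.mono Set.sdiff_subset⟩
  refine hM'.insert_of_not_saturates hab ?_ (hM.not_saturates_sdiff hbc (Sym2.mem_mk_left b c))
  rintro ⟨e, he, hae⟩
  exact ha ⟨e, he.1, hae⟩

theorem IsMatchingSet.not_saturates_exchange {V : Type} {G : SimpleGraph V} {M : Set (Sym2 V)}
    (hM : IsMatchingSet G M) {a b c : V} (ha : ¬ MSaturates M a)
    (hbc : s(b, c) ∈ M) : ¬ MSaturates (insert s(a, b) (M \ {s(b, c)})) c := by
  rintro ⟨e, rfl | he, hce⟩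
  · rcases Sym2.mem_iff.1 hce with rfl | rfl
    · exact ha ⟨_, hbc, Sym2.mem_mk_right _ _⟩
    · exact G.loopless.irrefl _ (hM.1 hbc)
  · exact hM.not_saturates_sdiff hbc (Sym2.mem_mk_right b c) ⟨e, he, hce⟩

theorem ncard_exchange_of_not_saturates {V : Type} {M : Set (Sym2 V)}
    {a b c : V} (ha : ¬ MSaturates M a) (hbc : s(b, c) ∈ M) :
    (insert s(a, b) (M \ {s(b, c)})).ncard = M.ncard :=
  Set.ncard_exchange (fun h => ha ⟨_, h, Sym2.mem_mk_left a b⟩) hbc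

theorem bddAbove_matching_sizes {V : Type} [Finite V] (G : SimpleGraph V) :
    BddAbove {n | ∃ M : Set (Sym2 V), IsMatchingSet G M ∧ M.ncard = n} := by
  refine ⟨(Set.univ : Set (Sym2 V)).ncard, ?_⟩
  rintro n ⟨M, -, rfl⟩
  exact Set.ncard_le_ncard (Set.subset_univ M)

theorem IsMatchingSet.ncard_le_nu {V : Type} [Finite V] {G : SimpleGraph V} {M : Set (Sym2 V)}
    (hM : IsMatchingSet G M) : M.ncard ≤ nu G :=
  le_csSup (bddAbove_matching_sizes G) ⟨M, hM, rfl⟩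

theorem exists_isMatchingSet_ncard_eq_nu {V : Type} [Finite V] (G : SimpleGraph V) :
    ∃ M : Set (Sym2 V), IsMatchingSet G M ∧ M.ncard = nu G :=
  Nat.sSup_mem (s := {n | ∃ M : Set (Sym2 V), IsMatchingSet G M ∧ M.ncard = n})
    ⟨0, ∅, ⟨Set.empty_subset _, Set.pairwise_empty _⟩, Set.ncard_empty _⟩
    (bddAbove_matching_sizes G)

theorem IsMatchingSet.image_val {V : Type} {G : SimpleGraph V} {s : Set V}
    {M : Set (Sym2 s)} (hM : IsMatchingSet (G.induce s) M) :
    IsMatchingSet G (Sym2.map Subtype.val '' M) := by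
  constructor
  · rintro _ ⟨e, he, rfl⟩
    induction e with | _ x y => exact hM.1 he
  · rintro _ ⟨e, he, rfl⟩ _ ⟨f, hf, rfl⟩ hne x hxe hxf
    obtain ⟨y, hy, rfl⟩ := Sym2.mem_map.1 hxe
    obtain ⟨z, hz, hzy⟩ := Sym2.mem_map.1 hxf
    obtain rfl := Subtype.ext hzy
    exact hne (congrArg _ (hM.eq_of_mem he hf hy hz))

theorem IsMatchingSet.preimage_val {V : Type} {G : SimpleGraph V} (s : Set V)
    {M : Set (Sym2 V)} (hM : IsMatchingSet G M) :
    IsMatchingSet (G.induce s) (Sym2.map Subtype.val ⁻¹' M) := by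
  constructor
  · intro e he
    induction e with | _ x y => exact hM.1 he
  · intro e he f hf hne x hxe hxf
    exact hne (Sym2.map.injective Subtype.val_injective
      (hM.eq_of_mem he hf (Sym2.mem_map.2 ⟨x, hxe, rfl⟩) (Sym2.mem_map.2 ⟨x, hxf, rfl⟩)))

theorem nu_induce_le {V : Type} [Finite V] (G : SimpleGraph V) (s : Set V) :
    nu (G.induce s) ≤ nu G := by
  obtain ⟨M, hM, hcard⟩ := exists_isMatchingSet_ncard_eq_nu (G.induce s)
  rw [← hcard, ← Set.ncard_image_of_injective M (Sym2.map.injective Subtype.val_injective)]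
  exact hM.image_val.ncard_le_nu

theorem nu_induce_compl_singleton_eq_iff {V : Type} [Finite V] (G : SimpleGraph V) (v : V) :
    nu (G.induce ({v}ᶜ : Set V)) = nu G ↔
      ∃ M : Set (Sym2 V), IsMatchingSet G M ∧ M.ncard = nu G ∧ ¬ MSaturates M v := by
  constructor
  · intro h
    obtain ⟨M, hM, hcard⟩ := exists_isMatchingSet_ncard_eq_nu (G.induce ({v}ᶜ : Set V))
    refine ⟨_, hM.image_val, ?_, ?_⟩
    · rw [Set.ncard_image_of_injective M (Sym2.map.injective Subtype.val_injective), hcard, h]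
    · rintro ⟨_, ⟨e, -, rfl⟩, hv⟩
      obtain ⟨x, -, hx⟩ := Sym2.mem_map.1 hv
      exact x.2 hx
  · rintro ⟨M, hM, hcard, hv⟩
    refine (nu_induce_le G _).antisymm ?_
    have hrange : M ⊆ Set.range (Sym2.map (Subtype.val : ({v}ᶜ : Set V) → V)) := by
      intro e he
      induction e with | _ x y =>
      have hx : x ≠ v := by
        rintro rfl
        exact hv ⟨_, he, Sym2.mem_mk_left _ _⟩
      have hy : y ≠ v := by
        rintro rfl
        exact hv ⟨_, he, Sym2.mem_mk_right _ _⟩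
      exact ⟨s(⟨x, hx⟩, ⟨y, hy⟩), rfl⟩
    rw [← hcard, ← Set.ncard_preimage_of_injective_subset_range
      (Sym2.map.injective Subtype.val_injective) hrange]
    exact (hM.preimage_val _).ncard_le_nu

/-- Exchanging along a star path frees its terminal vertex. -/
theorem IsStarPath.exists_not_saturates {V : Type} {G : SimpleGraph V} {a v : V}
    (p : G.Walk a v) {M : Set (Sym2 V)} (hM : IsMatchingSet G M) (hp : IsStarPath M p) :
    ∃ N : Set (Sym2 V), IsMatchingSet G N ∧ N.ncard = M.ncard ∧ ¬ MSaturates N v :=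
  match p, hp with
  | .nil, hp => ⟨M, hM, rfl, hp.2.2.1⟩
  | .cons h .nil, hp => absurd hp.2.1 (by simp)
  | .cons (v := b) hab (.cons (v := c) hbc q), ⟨hpath, heven, ha, halt⟩ => by
    have hmem : s(b, c) ∈ M := (halt 1 (by simp)).2 odd_one
    rw [Walk.cons_isPath_iff, Walk.cons_isPath_iff, Walk.support_cons, List.mem_cons] at hpath
    obtain ⟨⟨hq, hbq⟩, haq⟩ := hpath
    have hstar : IsStarPath (insert s(a, b) (M \ {s(b, c)})) q := by
      refine ⟨hq, ?_, hM.not_saturates_exchange ha hmem, ?_⟩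
      · simpa [Nat.even_add_one] using heven
      · intro i hi
        have hshift := halt (i + 2) (by simpa using hi)
        have hne : ∀ x, q.edges[i] ≠ s(b, x) := fun x h =>
          hbq (q.fst_mem_support_of_mem_edges (h ▸ List.getElem_mem hi))
        have hne' : q.edges[i] ≠ s(a, b) := Sym2.eq_swap (a := a) (b := b) ▸ hne a
        simp only [Walk.edges_cons, List.getElem_cons_succ] at hshift
        simp only [Set.mem_insert_iff, Set.mem_sdiff, Set.mem_singleton_iff, hne', hne c, hshift]
        grind
    obtain ⟨N, hN, hcard, hv⟩ := hstar.exists_not_saturates q (hM.exchange hab ha hmem)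
    exact ⟨N, hN, hcard.trans (ncard_exchange_of_not_saturates ha hmem), hv⟩

/-- A vertex missed by some maximum matching `N` is the end of a star path relative to `M`
whose non-matching edges lie in `N`. -/
theorem exists_isStarPath_of_not_saturates {V : Type} [Finite V] {G : SimpleGraph V}
    {M : Set (Sym2 V)} (hM : IsMatchingSet G M) (n : ℕ) :
    ∀ (N : Set (Sym2 V)) (v : V), (N \ M).ncard = n → IsMatchingSet G N → N.ncard = nu G →
      ¬ MSaturates N v → ∃ (a : V) (p : G.Walk a v), IsStarPath M p ∧
        ∀ x ∈ p.support, x ≠ v → MSaturates (N \ M) x := by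
  induction n using Nat.strong_induction_on with
  | _ n ih =>
    intro N v hn hN hcard hv
    by_cases hvM : MSaturates M v
    · obtain ⟨e, he, hve⟩ := hvM
      obtain ⟨w, rfl⟩ := Sym2.mem_iff_exists.1 hve
      have hvw : G.Adj v w := hM.1 he
      have hw : MSaturates N w := by
        by_contra hw
        have hle := (hN.insert_of_not_saturates hvw hv hw).ncard_le_nu
        rw [Set.ncard_insert_of_notMem fun h => hv ⟨_, h, hve⟩] at hle
        omega
      obtain ⟨f, hf, hwf⟩ := hw
      obtain ⟨u, rfl⟩ := Sym2.mem_iff_exists.1 hwf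
      have huv : u ≠ v := by
        rintro rfl
        exact hv ⟨_, hf, Sym2.mem_mk_right _ _⟩
      have hwu : G.Adj w u := hN.1 hf
      have hfM : s(w, u) ∉ M := by
        intro h
        have := hM.eq_of_mem h he (Sym2.mem_mk_left w u) (Sym2.mem_mk_right v w)
        have hmem : u ∈ s(v, w) := this ▸ Sym2.mem_mk_right w u
        rcases Sym2.mem_iff.1 hmem with h' | h'
        · exact huv h'
        · exact hwu.ne h'.symm
      have hdiff : insert s(v, w) (N \ {s(w, u)}) \ M = (N \ M) \ {s(w, u)} := by
        ext e
        simp only [Set.mem_sdiff, Set.mem_insert_iff, Set.mem_singleton_iff]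
        grind
      have hlt : ((N \ M) \ {s(w, u)}).ncard < n :=
        hn ▸ Set.ncard_sdiff_singleton_lt_of_mem ⟨hf, hfM⟩
      obtain ⟨a, p, ⟨hpath, heven, ha, halt⟩, hsupp⟩ :=
        ih _ hlt (insert s(v, w) (N \ {s(w, u)})) u (by rw [hdiff])
          (hN.exchange hvw hv hf) ((ncard_exchange_of_not_saturates hv hf).trans hcard)
          (hN.not_saturates_exchange hv hf)
      rw [hdiff] at hsupp
      have hvp : v ∉ p.support := by
        intro h
        obtain ⟨e, he', hve'⟩ := hsupp v h huv.symm
        exact hv ⟨e, he'.1.1, hve'⟩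
      have hwp : w ∉ p.support := by
        intro h
        obtain ⟨e, he', hwe⟩ := hsupp w h hwu.ne
        exact hN.not_saturates_sdiff hf hwf ⟨e, ⟨he'.1.1, he'.2⟩, hwe⟩
      refine ⟨a, (p.concat hwu.symm).concat hvw.symm, ⟨?_, ?_, ha, ?_⟩, ?_⟩
      · refine (hpath.concat hwp _).concat ?_ _
        simp [Walk.support_concat, hvp, hvw.ne]
      · simpa [Nat.even_add_one] using heven
      · intro i hi
        have hlen : p.edges.length = p.length := p.length_edges
        simp only [Walk.edges_concat, List.concat_eq_append, List.append_assoc,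
          List.length_append, List.length_cons, List.length_nil, List.cons_append,
          List.nil_append] at hi ⊢
        rcases lt_trichotomy i p.edges.length with h | rfl | h
        · rw [List.getElem_append_left h]
          exact halt i h
        · simp [hlen, heven, Sym2.eq_swap (a := u), hfM]
        · obtain rfl : i = p.edges.length + 1 := by omega
          simp [hlen, heven.add_one, Sym2.eq_swap (a := w) (b := v), he]
      · intro x hx hxv
        simp only [Walk.support_concat, List.mem_append,
          List.mem_singleton] at hx
        rcases hx with (hx | rfl) | rfl
        · by_cases hxu : x = u
          · exact ⟨_, ⟨hf, hfM⟩, hxu ▸ Sym2.mem_mk_right w u⟩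
          · obtain ⟨e, he', hxe⟩ := hsupp x hx hxu
            exact ⟨e, he'.1, hxe⟩
        · exact ⟨_, ⟨hf, hfM⟩, hwf⟩
        · exact absurd rfl hxv
    · refine ⟨v, .nil, ⟨.nil, by simp, hvM, fun i hi => by simp at hi⟩, ?_⟩
      intro x hx hxv
      exact absurd (by simpa using hx) hxv

/-- `ν(G \ v) = ν(G)` for all `v` iff for every maximum matching `M` every
vertex of `G` is a star vertex relative to `M`. -/
theorem stmt_7 {V : Type} [Fintype V] (G : SimpleGraph V) :
    (∀ v : V, nu (G.induce ({v}ᶜ : Set V)) = nu G) ↔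
      (∀ M : Set (Sym2 V), IsMatchingSet G M → M.ncard = nu G →
        ∀ v : V, IsStarVertex G M v) := by
  constructor
  · intro h M hM _ v
    obtain ⟨N, hN, hcard, hv⟩ := (nu_induce_compl_singleton_eq_iff G v).1 (h v)
    obtain ⟨a, p, hp, -⟩ := exists_isStarPath_of_not_saturates hM _ N v rfl hN hcard hv
    exact ⟨a, p, hp⟩
  · intro h v
    obtain ⟨M, hM, hcard⟩ := exists_isMatchingSet_ncard_eq_nu G
    obtain ⟨a, p, hp⟩ := h M hM hcard v
    obtain ⟨N, hN, hNcard, hv⟩ := hp.exists_not_saturates p hM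
    exact (nu_induce_compl_singleton_eq_iff G v).2 ⟨N, hN, hNcard.trans hcard, hv⟩
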